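/- arXiv:2412.13792 — 2 statements merged into one kernel-verified Lean document; each statement's English description precedes it below -/
import Mathlib

section
/- Under the setup, if H is a nontrivial component of G*[U] with γ(H) > 0, then Σ_{u∈V(H)} x_u > (5/2)·x_{u*}. -/
open SimpleGraph Finset
open scoped Classical

/-- The spectral radius of a finite simple graph: the largest eigenvalue of its
adjacency matrix (expressed as the supremum of the set of eigenvalues). -/
noncomputable def specRad {V : Type*} [Fintype V] (G : SimpleGraph V) : ℝ :=
  sSup {t : ℝ | Module.End.HasEigenvalue (Matrix.toLin' (G.adjMatrix ℝ)) t}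

/-- The fan graph `F₆ = K₁ ∨ P₅`: the path `0-1-2-3-4` together with the hub `5`
adjacent to all of `0,…,4`. -/
def fan6 : SimpleGraph (Fin 6) :=
  SimpleGraph.fromRel (fun a b => b = 5 ∨ (b.val = a.val + 1 ∧ b.val ≤ 4))

/-- A graph is `F₆`-free if it contains no subgraph isomorphic to the fan `F₆`,
i.e. there is no injective graph homomorphism from `F₆` into it. -/
def F6Free {V : Type*} (G : SimpleGraph V) : Prop :=
  ¬ ∃ f : fan6 →g G, Function.Injective f

/-- The join `K₂ ∨ kK₁`: two adjacent vertices, each adjacent to `k` further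
pairwise non-adjacent vertices. -/
def K2JoinEmpty (k : ℕ) : SimpleGraph (Fin 2 ⊕ Fin k) :=
  SimpleGraph.fromRel (fun a b => a.isLeft ∨ b.isLeft)

/-- `dS G S v` is the number of neighbors of `v` lying in `S`. -/
noncomputable def dS {V : Type*} (G : SimpleGraph V) (S : Set V) (v : V) : ℕ :=
  (G.neighborSet v ∩ S).ncard

/-- `eIn G S` is the number of edges of the induced subgraph `G[S]`. -/
noncomputable def eIn {V : Type*} (G : SimpleGraph V) (S : Set V) : ℕ :=
  {e ∈ G.edgeSet | ∀ v ∈ e, v ∈ S}.ncard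

/-- `eBetween G S T` is the number of edges with one endpoint in `S` and the
other in `T`. -/
noncomputable def eBetween {V : Type*} (G : SimpleGraph V) (S T : Set V) : ℕ :=
  {e ∈ G.edgeSet | ∃ a ∈ S, ∃ b ∈ T, e = s(a, b)}.ncard

/-- `gamma G x ustar S = Σ_{u∈S} (d_S(u) - 1)·x_u/x_{u*} - e(S)`. -/
noncomputable def gamma {V : Type*} [Fintype V] (G : SimpleGraph V) (x : V → ℝ)
    (ustar : V) (S : Set V) : ℝ :=
  (∑ u ∈ S.toFinset, ((dS G S u : ℝ) - 1) * (x u / x ustar)) - eIn G S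

/-- The star `K_{1,r}` with center `0` and `r` leaves. -/
def starGraph (r : ℕ) : SimpleGraph (Fin (r + 1)) :=
  SimpleGraph.fromRel (fun a _ => a = 0)

/-- `K_{1,r} + e`: the star with center `0` and `r` leaves, plus an edge joining
the two leaves `1` and `2`. -/
def starPlusEdge (r : ℕ) : SimpleGraph (Fin (r + 1)) :=
  SimpleGraph.fromRel (fun a b => a = 0 ∨ (a = 1 ∧ b = 2))

/-- The double star `D_{a,b}`: centers `0` and `1` joined by an edge, `0` joined
to the `a` leaves `2,…,a+1`, and `1` joined to the `b` leaves `a+2,…,a+b+1`. -/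
def doubleStar (a b : ℕ) : SimpleGraph (Fin (a + b + 2)) :=
  SimpleGraph.fromRel (fun u v =>
    (u.val = 0 ∧ v.val = 1) ∨ (u.val = 0 ∧ 2 ≤ v.val ∧ v.val < a + 2) ∨
      (u.val = 1 ∧ a + 2 ≤ v.val))

/-- `K₄ - e`: the complete graph on 4 vertices minus the edge `{0,1}`. -/
def K4MinusE : SimpleGraph (Fin 4) :=
  SimpleGraph.fromRel (fun u v => ¬(u = 0 ∧ v = 1) ∧ ¬(u = 1 ∧ v = 0))

/-- `G` contains no path on five vertices as a (not necessarily induced) subgraph. -/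
def P5Free {W : Type*} (K : SimpleGraph W) : Prop :=
  ∀ a b c d e : W, K.Adj a b → K.Adj b c → K.Adj c d → K.Adj d e → ¬ [a, b, c, d, e].Nodup

theorem F6Free.p5Free_induce {V : Type*} {G : SimpleGraph V} (hfree : F6Free G) {v : V}
    {S : Set V} (hS : S ⊆ G.neighborSet v) : P5Free (G.induce S) := by
  intro a b c d e hab hbc hcd hde hnd
  apply hfree
  simp only [comap_adj, Function.Embedding.subtype_apply] at hab hbc hcd hde
  have ha : G.Adj v a := hS a.2
  have hb : G.Adj v b := hS b.2
  have hc : G.Adj v c := hS c.2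
  have hd : G.Adj v d := hS d.2
  have he : G.Adj v e := hS e.2
  simp only [List.nodup_cons, List.mem_cons, List.not_mem_nil, or_false, not_or, ← Subtype.coe_inj,
    List.nodup_nil, not_false_eq_true, and_true] at hnd
  refine ⟨⟨![(a : V), b, c, d, e, v], ?_⟩, ?_⟩
  · intro i j hij
    fin_cases i <;> fin_cases j <;> simp [fan6] at hij ⊢ <;> simp_all [G.adj_comm]
  · intro i j hij
    have := ha.ne
    have := hb.ne
    have := hc.ne
    have := hd.ne
    have := he.ne
    fin_cases i <;> fin_cases j <;> simp at hij ⊢ <;> grind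

theorem SimpleGraph.Preconnected.exists_adj_mem_notMem {W : Type*} {K : SimpleGraph W}
    (hK : K.Preconnected) {S : Set W} {u w : W} (hu : u ∈ S) (hw : w ∉ S) :
    ∃ a b, a ∈ S ∧ b ∉ S ∧ K.Adj a b := by
  obtain ⟨p⟩ := hK u w
  obtain ⟨d, -, h1, h2⟩ := p.exists_boundary_dart S hu hw
  exact ⟨d.fst, d.snd, h1, h2, d.adj⟩

section

variable {W : Type*} {K : SimpleGraph W}

theorem P5Free.not_four_cycle [Fintype W] (hP : P5Free K) (hK : K.Connected)
    (hcard : 5 ≤ Fintype.card W) {a b c d : W} (hab : K.Adj a b) (hbc : K.Adj b c)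
    (hcd : K.Adj c d) (hda : K.Adj d a) (hac : a ≠ c) (hbd : b ≠ d) : False := by
  obtain ⟨w, hw⟩ : ∃ w, w ∉ ({a, b, c, d} : Finset W) := by
    by_contra! h
    have := Finset.card_le_card (fun w _ => h w : (univ : Finset W) ⊆ _)
    have := Finset.card_le_four (a := a) (b := b) (c := c) (d := d)
    simp only [card_univ] at *
    lia
  obtain ⟨u, v, hu, hv, huv⟩ := hK.preconnected.exists_adj_mem_notMem
    (S := (({a, b, c, d} : Finset W) : Set W)) (u := a) (by simp) hw
  have := hab.ne
  have := hbc.ne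
  have := hcd.ne
  have := hda.ne
  simp only [coe_insert, coe_singleton, Set.mem_insert_iff, Set.mem_singleton_iff, not_or] at hu hv
  rcases hu with rfl | rfl | rfl | rfl
  · exact hP v u b c d huv.symm hab hbc hcd (by simp; grind)
  · exact hP v u c d a huv.symm hbc hcd hda (by simp; grind)
  · exact hP v u d a b huv.symm hcd hda hab (by simp; grind)
  · exact hP v u a b c huv.symm hda hab hbc (by simp; grind)

theorem P5Free.card_edgeFinset_le_of_triangle_of_adj [Fintype W] [Fintype K.edgeSet]
    (hP : P5Free K) (hK : K.Connected)
    (hcard : 5 ≤ Fintype.card W) {a b c d : W} (hab : K.Adj a b) (hbc : K.Adj b c)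
    (hca : K.Adj c a) (had : K.Adj a d) (hdb : d ≠ b) (hdc : d ≠ c) :
    #K.edgeFinset ≤ Fintype.card W := by
  have nab := hab.ne
  have nbc := hbc.ne
  have nca := hca.ne
  have nad := had.ne
  have hb : ∀ w, K.Adj b w → w = a ∨ w = c := by
    intro w hw
    by_contra! h
    have := hw.ne
    by_cases hwd : w = d
    · subst hwd
      exact hP.not_four_cycle hK hcard had.symm hca.symm hbc.symm hw hdc nab
    · exact hP d a c b w had.symm hca.symm hbc.symm hw (by simp; grind)
  have hc : ∀ w, K.Adj c w → w = a ∨ w = b := by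
    intro w hw
    by_contra! h
    have := hw.ne
    by_cases hwd : w = d
    · subst hwd
      exact hP.not_four_cycle hK hcard had.symm hab hbc hw hdb nca.symm
    · exact hP d a b c w had.symm hab hbc hw (by simp; grind)
  have ha : ∀ w, w = a ∨ K.Adj a w := by
    by_contra! ⟨w, hw⟩
    obtain ⟨u, v, hu, hv, huv⟩ := hK.preconnected.exists_adj_mem_notMem
      (S := {w | w = a ∨ K.Adj a w}) (u := a) (w := w) (by simp) (by simpa using hw)
    simp only [Set.mem_ofPred_eq, not_or] at hu hv
    rcases hu with rfl | hu
    · exact hv.2 huv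
    by_cases hub : u = b
    · subst hub
      rcases hb v huv with rfl | rfl
      · exact hv.1 rfl
      · exact hv.2 hca.symm
    by_cases huc : u = c
    · subst huc
      rcases hc v huv with rfl | rfl
      · exact hv.1 rfl
      · exact hv.2 hab
    have := hu.ne
    have := huv.ne
    have hvb : v ≠ b := by rintro rfl; exact hv.2 hab
    have hvc : v ≠ c := by rintro rfl; exact hv.2 hca.symm
    exact hP v u a b c huv.symm hu.symm hab hbc (by simp; grind)
  have hsub : K.edgeFinset ⊆ univ.image (fun v => if v = a then s(b, c) else s(a, v)) := by
    intro e
    induction e with | _ u v => ?_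
    simp only [mem_edgeFinset, mem_edgeSet, mem_image, mem_univ, true_and]
    intro huv
    by_cases hua : u = a
    · exact ⟨v, by subst hua; simp [huv.ne']⟩
    by_cases hva : v = a
    · exact ⟨u, by subst hva; simp [huv.ne, Sym2.eq_swap]⟩
    refine ⟨a, ?_⟩
    rw [if_pos rfl]
    by_cases hub : u = b
    · subst hub
      rcases hb v huv with h | h
      · exact absurd h hva
      · rw [h]
    by_cases huc : u = c
    · subst huc
      rcases hc v huv with h | h
      · exact absurd h hva
      · rw [h, Sym2.eq_swap]
    by_cases hvb : v = b
    · subst hvb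
      rcases hb u huv.symm with h | h
      · exact absurd h hua
      · exact absurd h huc
    by_cases hvc : v = c
    · subst hvc
      rcases hc u huv.symm with h | h
      · exact absurd h hua
      · exact absurd h hub
    have := huv.ne
    have hav := (ha v).resolve_left hva
    exact absurd (by simp; grind) (hP u v a b c huv hav.symm hab hbc)
  exact (card_le_card hsub).trans card_image_le

theorem P5Free.card_edgeFinset_le_of_triangle [Fintype W] [Fintype K.edgeSet]
    (hP : P5Free K) (hK : K.Connected)
    (hcard : 5 ≤ Fintype.card W) {a b c : W} (hab : K.Adj a b) (hbc : K.Adj b c)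
    (hca : K.Adj c a) : #K.edgeFinset ≤ Fintype.card W := by
  obtain ⟨w, hw⟩ : ∃ w, w ∉ ({a, b, c} : Finset W) := by
    by_contra! h
    have := Finset.card_le_card (fun w _ => h w : (univ : Finset W) ⊆ _)
    have := Finset.card_le_three (a := a) (b := b) (c := c)
    simp only [card_univ] at *
    lia
  obtain ⟨u, v, hu, hv, huv⟩ := hK.preconnected.exists_adj_mem_notMem
    (S := (({a, b, c} : Finset W) : Set W)) (u := a) (by simp) hw
  simp only [coe_insert, coe_singleton, Set.mem_insert_iff, Set.mem_singleton_iff, not_or] at hu hv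
  rcases hu with rfl | rfl | rfl
  · exact hP.card_edgeFinset_le_of_triangle_of_adj hK hcard hab hbc hca huv hv.2.1 hv.2.2
  · exact hP.card_edgeFinset_le_of_triangle_of_adj hK hcard hbc hca hab huv hv.2.2 hv.1
  · exact hP.card_edgeFinset_le_of_triangle_of_adj hK hcard hca hab hbc huv hv.1 hv.2.1

/-- A connected graph on at least five vertices without a five-vertex path is at most unicyclic. -/
theorem P5Free.card_edgeFinset_le [Fintype W] [Fintype K.edgeSet] (hP : P5Free K)
    (hK : K.Connected) (hcard : 5 ≤ Fintype.card W) : #K.edgeFinset ≤ Fintype.card W := by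
  by_cases hac : K.IsAcyclic
  · have := (IsTree.mk hK hac).card_edgeFinset
    lia
  simp only [IsAcyclic, not_forall, not_not] at hac
  obtain ⟨v, p, hp⟩ := hac
  have h3 := hp.three_le_length
  have hinj : ∀ i j, i < p.length → j < p.length → i ≠ j → p.getVert i ≠ p.getVert j := by
    intro i j hi hj hij h
    exact hij (hp.getVert_injOn' (by simp; lia) (by simp; lia) h)
  have h01 := p.adj_getVert_succ (i := 0) (by lia)
  have h12 := p.adj_getVert_succ (i := 1) (by lia)
  have h23 := p.adj_getVert_succ (i := 2) (by lia)
  have hlen : p.getVert p.length = p.getVert 0 := by simp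
  rcases Nat.lt_or_ge 3 p.length with h4 | h4
  · have h34 := p.adj_getVert_succ (i := 3) (by lia)
    rcases Nat.lt_or_ge 4 p.length with h5 | h5
    · have h45 := p.adj_getVert_succ (i := 4) (by lia)
      refine absurd ?_ (hP _ _ _ _ _ h01 h12 h23 h34)
      simp only [List.nodup_cons, List.mem_cons, List.not_mem_nil, or_false, not_or,
        List.nodup_nil, not_false_eq_true, and_true]
      refine ⟨⟨?_, ?_, ?_, ?_⟩, ⟨?_, ?_, ?_⟩, ⟨?_, ?_⟩, ?_⟩ <;>
        exact hinj _ _ (by lia) (by lia) (by lia)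
    · rw [show 3 + 1 = p.length by lia, hlen] at h34
      exact (hP.not_four_cycle hK hcard h01 h12 h23 h34 (hinj _ _ (by lia) (by lia) (by lia))
        (hinj _ _ (by lia) (by lia) (by lia))).elim
  · rw [show 2 + 1 = p.length by lia, hlen] at h23
    exact hP.card_edgeFinset_le_of_triangle hK hcard h01 h12 h23

theorem P5Free.five_halves_lt_sum [Fintype W] (hP : P5Free K)
    (hK : K.Connected) [Nontrivial W] {y : W → ℝ} (hy0 : ∀ u, 0 ≤ y u) (hy1 : ∀ u, y u ≤ 1)
    (hpos : 0 < ∑ u, ((K.degree u : ℝ) - 1) * y u - #K.edgeFinset) : 5 / 2 < ∑ u, y u := by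
  have hlt : Fintype.card W < #K.edgeFinset := by
    have hle : ∑ u, ((K.degree u : ℝ) - 1) * y u ≤ ∑ u, ((K.degree u : ℝ) - 1) := by
      refine sum_le_sum fun u _ => mul_le_of_le_one_right ?_ (hy1 u)
      have : 1 ≤ K.degree u := hK.preconnected.degree_pos_of_nontrivial u
      simpa using this
    have hdeg : ∑ u, (K.degree u : ℝ) = 2 * #K.edgeFinset := by
      exact_mod_cast K.sum_degrees_eq_twice_card_edges
    rw [sum_sub_distrib, hdeg] at hle
    simp only [sum_const, card_univ, nsmul_eq_mul, mul_one] at hle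
    exact_mod_cast (by linarith : (Fintype.card W : ℝ) < #K.edgeFinset)
  have hcard : Fintype.card W ≤ 4 := by
    by_contra! h
    exact absurd (hP.card_edgeFinset_le hK h) hlt.not_ge
  have hedge : 5 ≤ #K.edgeFinset := by
    have hch := K.card_edgeFinset_le_card_choose_two
    generalize Fintype.card W = n at *
    interval_cases n <;> simp only [Nat.choose] at hch <;> lia
  have hle : ∑ u, ((K.degree u : ℝ) - 1) * y u ≤ ∑ u, 2 * y u := by
    refine sum_le_sum fun u _ => mul_le_mul_of_nonneg_right ?_ (hy0 u)
    have : K.degree u ≤ 3 := by have := K.degree_lt_card_verts u; lia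
    have : (K.degree u : ℝ) ≤ 3 := by exact_mod_cast this
    linarith
  rw [← mul_sum] at hle
  have : (5 : ℝ) ≤ #K.edgeFinset := by exact_mod_cast hedge
  linarith

end

theorem dS_eq_degree_induce {V : Type*} [Fintype V] (G : SimpleGraph V) (S : Set V) (u : S) :
    dS G S u = (G.induce S).degree u := by
  rw [dS, ← card_neighborSet_eq_degree, ← Nat.card_eq_fintype_card, Nat.card_coe_set_eq,
    ← Set.ncard_image_of_injective _ Subtype.val_injective]
  congr 1
  ext w
  simp [and_comm]

theorem eIn_eq_card_edgeFinset_induce {V : Type*} [Fintype V] (G : SimpleGraph V) (S : Set V) :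
    eIn G S = #(G.induce S).edgeFinset := by
  rw [eIn, ← Set.ncard_coe_finset, coe_edgeFinset,
    ← Set.ncard_image_of_injective _ (Sym2.map.injective Subtype.val_injective)]
  congr 1
  ext e
  constructor
  · induction e with | _ u v => ?_
    rintro ⟨he, hS⟩
    exact ⟨s(⟨u, hS u (by simp)⟩, ⟨v, hS v (by simp)⟩), by simpa using he, by simp⟩
  · rintro ⟨e, he, rfl⟩
    induction e with | _ u v => ?_
    exact ⟨by simpa using he, by simp⟩

theorem gamma_eq_sum_degree_induce {V : Type*} [Fintype V] (G : SimpleGraph V) (x : V → ℝ) (v : V)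
    (S : Set V) : gamma G x v S =
      ∑ u : S, (((G.induce S).degree u : ℝ) - 1) * (x u / x v) - #(G.induce S).edgeFinset := by
  rw [gamma, eIn_eq_card_edgeFinset_induce, ← sum_set_coe]
  simp only [dS_eq_degree_induce]

theorem F6Free.five_halves_mul_lt_sum {V : Type*} [Fintype V] {G : SimpleGraph V}
    (hfree : F6Free G) {v : V} {S : Set V} [Nontrivial S] (hS : S ⊆ G.neighborSet v)
    (hK : (G.induce S).Connected) {x : V → ℝ} (hx : ∀ u, 0 < x u) (hxv : ∀ u, x u ≤ x v)
    (hpos : 0 < gamma G x v S) : 5 / 2 * x v < ∑ u ∈ S.toFinset, x u := by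
  rw [gamma_eq_sum_degree_induce] at hpos
  have key := (hfree.p5Free_induce hS).five_halves_lt_sum hK (y := fun u => x u / x v)
    (fun u => (div_pos (hx u) (hx v)).le) (fun u => (div_le_one (hx v)).2 (hxv u)) hpos
  rw [← sum_div, lt_div_iff₀ (hx v)] at key
  rwa [← sum_set_coe]

theorem stmt_10 
    {V : Type} [Fintype V] [DecidableEq V] (G : SimpleGraph V) [DecidableRel G.Adj]
    (m : ℕ) (hm : 88 ≤ m)
    (hfree : F6Free G)
    (hcard : G.edgeSet.ncard = m)
    (hnoiso : ∀ v : V, ∃ w, G.Adj v w)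
    (hmax : ∀ (n : ℕ) (G' : SimpleGraph (Fin n)), F6Free G' → G'.edgeSet.ncard = m →
      (∀ v, ∃ w, G'.Adj v w) → specRad G' ≤ specRad G)
    (lam : ℝ) (hlam : lam = specRad G)
    (hconn : G.Connected)
    (hlow : (1 + Real.sqrt (4 * (m : ℝ) - 3)) / 2 ≤ lam)
    (x : V → ℝ) (hxpos : ∀ v, 0 < x v)
    (heig : (G.adjMatrix ℝ).mulVec x = lam • x)
    (ustar : V) (hustar : ∀ v, x v ≤ x ustar)
   
    (C : (G.induce (G.neighborSet ustar)).ConnectedComponent)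
    (hnt : ∃ a b, a ∈ C.supp ∧ b ∈ C.supp ∧ (G.induce (G.neighborSet ustar)).Adj a b)
    (hpos : 0 < gamma G x ustar (Subtype.val '' C.supp)) :
    (5 / 2 : ℝ) * x ustar < ∑ u ∈ (Subtype.val '' C.supp).toFinset, x u := by
  set S : Set V := Subtype.val '' C.supp
  have hSN : S ⊆ G.neighborSet ustar := by
    rintro _ ⟨u, -, rfl⟩
    exact u.2
  have hK : (G.induce S).Connected := by
    let f : C.toSimpleGraph →g G.induce S :=
      ⟨fun u => ⟨u.1.1, u.1, u.2, rfl⟩, fun h => h⟩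
    refine C.connected_toSimpleGraph.map f ?_
    rintro ⟨_, u, hu, rfl⟩
    exact ⟨⟨u, hu⟩, rfl⟩
  have : Nontrivial S := by
    obtain ⟨a, b, ha, hb, hab⟩ := hnt
    exact ⟨⟨a, a, ha, rfl⟩, ⟨b, b, hb, rfl⟩, fun h => hab.ne (Subtype.ext (Subtype.mk.inj h))⟩
  convert hfree.five_halves_mul_lt_sum hSN hK hxpos hustar hpos
end

section
/- Under the setup, no component of the induced subgraph G*[U] is isomorphic to the complete graph K_4. -/
open SimpleGraph Finset
open scoped Classical

/-- A graph with no path on five vertices as a (not necessarily induced) subgraph. -/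
def NoP5 {T : Type*} (Γ : SimpleGraph T) : Prop :=
  ∀ p₁ p₂ p₃ p₄ p₅ : T, Γ.Adj p₁ p₂ → Γ.Adj p₂ p₃ → Γ.Adj p₃ p₄ → Γ.Adj p₄ p₅ →
    p₁ ≠ p₃ → p₁ ≠ p₄ → p₁ ≠ p₅ → p₂ ≠ p₄ → p₂ ≠ p₅ → p₃ ≠ p₅ → False

/-- `{u, a, b, c}` is a union of components of `Γ` in which `u` and `b` are adjacent to all the
other vertices, so that it spans a `K₄` or a `K₄` minus the edge `ac`. -/
structure IsDiamond {T : Type*} (Γ : SimpleGraph T) (u a b c : T) : Prop where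
  ua : Γ.Adj u a
  ub : Γ.Adj u b
  uc : Γ.Adj u c
  ba : Γ.Adj b a
  bc : Γ.Adj b c
  ne : a ≠ c
  closed : ∀ v w, v = u ∨ v = a ∨ v = b ∨ v = c → Γ.Adj v w → w = u ∨ w = a ∨ w = b ∨ w = c

/-- In an `F₆`-free graph no neighbourhood contains a path on five vertices. -/
lemma F6Free.false_of_fan {V : Type*} {G : SimpleGraph V} (hG : F6Free G) {h p₁ p₂ p₃ p₄ p₅ : V}
    (h₁ : G.Adj h p₁) (h₂ : G.Adj h p₂) (h₃ : G.Adj h p₃) (h₄ : G.Adj h p₄) (h₅ : G.Adj h p₅)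
    (e₁ : G.Adj p₁ p₂) (e₂ : G.Adj p₂ p₃) (e₃ : G.Adj p₃ p₄) (e₄ : G.Adj p₄ p₅)
    (n₁₃ : p₁ ≠ p₃) (n₁₄ : p₁ ≠ p₄) (n₁₅ : p₁ ≠ p₅) (n₂₄ : p₂ ≠ p₄) (n₂₅ : p₂ ≠ p₅)
    (n₃₅ : p₃ ≠ p₅) : False := by
  refine hG ⟨⟨![p₁, p₂, p₃, p₄, p₅, h], ?_⟩, ?_⟩
  · intro i j hij
    fin_cases i <;> fin_cases j <;>
      simp_all [fan6, SimpleGraph.fromRel_adj, SimpleGraph.adj_comm]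
  · have := h₁.ne
    have := h₂.ne
    have := h₃.ne
    have := h₄.ne
    have := h₅.ne
    have := e₁.ne
    have := e₂.ne
    have := e₃.ne
    have := e₄.ne
    intro i j hij
    fin_cases i <;> fin_cases j <;> simp_all [eq_comm]

lemma F6Free.noP5_induce {V : Type*} {G : SimpleGraph V} (hG : F6Free G) (s : V) :
    NoP5 (G.induce (G.neighborSet s)) := by
  intro p₁ p₂ p₃ p₄ p₅ e₁ e₂ e₃ e₄ n₁₃ n₁₄ n₁₅ n₂₄ n₂₅ n₃₅
  simp only [comap_adj, Function.Embedding.subtype_apply, ne_eq, Subtype.ext_iff] at *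
  exact hG.false_of_fan p₁.2 p₂.2 p₃.2 p₄.2 p₅.2 e₁ e₂ e₃ e₄ n₁₃ n₁₄ n₁₅ n₂₄ n₂₅ n₃₅

/-- A vertex outside the closed neighbourhood of `s` is not adjacent to both ends of an edge `hp`
in a triangle `hpr` with a pendant edge `hq` inside the neighbourhood of `s`. -/
lemma F6Free.not_adj_of_adj {V : Type*} {G : SimpleGraph V} (hG : F6Free G) {s w h p q r : V}
    (hw : ¬ G.Adj s w) (sh : G.Adj s h) (sp : G.Adj s p) (sq : G.Adj s q)
    (sr : G.Adj s r) (hp : G.Adj h p) (hq : G.Adj h q) (hr : G.Adj h r) (pr : G.Adj p r)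
    (pq : p ≠ q) (rq : r ≠ q) (hws : w ≠ s) (wh : G.Adj w h) : ¬ G.Adj w p := fun wp =>
  hG.false_of_fan (h := h) (p₁ := w) (p₂ := p) (p₃ := r) (p₄ := s) (p₅ := q)
    wh.symm hp hr sh.symm hq wp pr sr.symm sq (fun e => hw (e ▸ sr)) hws
    (fun e => hw (e ▸ sq)) sp.ne' pq rq

lemma exists_adj_ne_of_degree_ne_one {T : Type*} [Fintype T] {Γ : SimpleGraph T} {u a : T}
    (hua : Γ.Adj u a) (ha : Γ.degree a ≠ 1) : ∃ w, Γ.Adj a w ∧ w ≠ u := by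
  by_contra! h
  refine ha (Finset.card_eq_one.2 ⟨u, ?_⟩)
  ext w
  simp only [mem_neighborFinset, Finset.mem_singleton]
  exact ⟨h w, fun e => e ▸ hua.symm⟩

/-- If `a`, `b`, `c` are neighbours of `u` and `a`, `b` have neighbours besides `u`, then those
of `a` are among `b` and `c`. -/
lemma NoP5.eq_or_eq_of_adj {T : Type*} {Γ : SimpleGraph T} (hP : NoP5 Γ) {u a b c a' b' : T}
    (ua : Γ.Adj u a) (ub : Γ.Adj u b) (uc : Γ.Adj u c) (hab : a ≠ b) (hac : a ≠ c) (hbc : b ≠ c)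
    (ha : Γ.Adj a a') (ha' : a' ≠ u) (hb : Γ.Adj b b') (hb' : b' ≠ u) : a' = b ∨ a' = c := by
  by_contra! h
  obtain ⟨h₁, h₂⟩ := h
  rcases eq_or_ne b' a with rfl | h₃
  · exact hP a' b' b u c ha.symm hb.symm ub.symm uc h₁ ha' h₂ ua.ne' hac hbc
  rcases eq_or_ne b' a' with rfl | h₄
  · exact hP a b' b u c ha hb.symm ub.symm uc hab ua.ne' hac ha' h₂ hbc
  exact hP a' a u b b' ha.symm ua.symm ub hb ha' h₁ h₄.symm hab h₃.symm hb'.symm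

lemma NoP5.exists_isDiamond {T : Type*} [Fintype T] {Γ : SimpleGraph T} (hP : NoP5 Γ) {u : T}
    (hu : 2 < #{v ∈ Γ.neighborFinset u | Γ.degree v ≠ 1}) : ∃ a b c, IsDiamond Γ u a b c := by
  obtain ⟨a, b, c, ha, hb, hc, hab, hac, hbc⟩ := Finset.two_lt_card_iff.1 hu
  simp only [Finset.mem_filter, mem_neighborFinset] at ha hb hc
  obtain ⟨a', aa', ha'⟩ := exists_adj_ne_of_degree_ne_one ha.1 ha.2
  obtain ⟨b', bb', hb'⟩ := exists_adj_ne_of_degree_ne_one hb.1 hb.2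
  obtain ⟨c', cc', hc'⟩ := exists_adj_ne_of_degree_ne_one hc.1 hc.2
  have na : ∀ w, Γ.Adj a w → w ≠ u → w = b ∨ w = c := fun w h₁ h₂ =>
    hP.eq_or_eq_of_adj ha.1 hb.1 hc.1 hab hac hbc h₁ h₂ bb' hb'
  have nb : ∀ w, Γ.Adj b w → w ≠ u → w = a ∨ w = c := fun w h₁ h₂ =>
    hP.eq_or_eq_of_adj hb.1 ha.1 hc.1 hab.symm hbc hac h₁ h₂ aa' ha'
  have nc : ∀ w, Γ.Adj c w → w ≠ u → w = a ∨ w = b := fun w h₁ h₂ =>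
    hP.eq_or_eq_of_adj hc.1 ha.1 hb.1 hac.symm hbc.symm hab h₁ h₂ aa' ha'
  have close : ∀ x y z, Γ.Adj u x → Γ.Adj u y → Γ.Adj u z → Γ.Adj y x → Γ.Adj y z → x ≠ z →
      (∀ w, Γ.Adj x w → w ≠ u → w = y ∨ w = z) → (∀ w, Γ.Adj y w → w ≠ u → w = x ∨ w = z) →
      (∀ w, Γ.Adj z w → w ≠ u → w = x ∨ w = y) → ∃ a b c, IsDiamond Γ u a b c := by
    intro x y z ux uy uz yx yz xz nx ny nz
    have nu : ∀ w, Γ.Adj u w → w = x ∨ w = y ∨ w = z := by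
      intro w uw
      by_contra! h
      exact hP x y z u w yx.symm yz uz.symm uw xz ux.ne' h.1.symm uy.ne' h.2.1.symm h.2.2.symm
    refine ⟨x, y, z, ux, uy, uz, yx, yz, xz, ?_⟩
    rintro v w (rfl | rfl | rfl | rfl) hvw
    · exact .inr (nu w hvw)
    · by_cases h : w = u
      · exact .inl h
      · have := nx w hvw h
        tauto
    · by_cases h : w = u
      · exact .inl h
      · have := ny w hvw h
        tauto
    · by_cases h : w = u
      · exact .inl h
      · have := nz w hvw h
        tauto
  rcases na a' aa' ha' with rfl | rfl
  · rcases nc c' cc' hc' with rfl | rfl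
    · exact close a' c' c hb.1 ha.1 hc.1 aa' cc'.symm hbc nb na fun w h₁ h₂ => (nc w h₁ h₂).symm
    · exact close a c' c ha.1 hb.1 hc.1 aa'.symm cc'.symm hac na nb nc
  · rcases nb b' bb' hb' with rfl | rfl
    · exact close b b' a' hb.1 ha.1 hc.1 bb'.symm aa' hbc nb na fun w h₁ h₂ => (nc w h₁ h₂).symm
    · exact close a b' b ha.1 hc.1 hb.1 aa'.symm bb'.symm hab
        (fun w h₁ h₂ => (na w h₁ h₂).symm) nc nb

/-- The contribution of `v` to `∑ v, ((d(v) - 1) x v - d(v) / 2)`, once every leaf has handed its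
`-1 / 2` over to its neighbour. -/
noncomputable def charge {T : Type*} [Fintype T] (Γ : SimpleGraph T) (x : T → ℝ) (v : T) : ℝ :=
  ((Γ.degree v : ℝ) - 1) * x v - Γ.degree v / 2 + (if Γ.degree v = 1 then 1 / 2 else 0)
    - (#{w ∈ Γ.neighborFinset v | Γ.degree w = 1} : ℝ) / 2

lemma sum_charge {T : Type*} [Fintype T] (Γ : SimpleGraph T) (x : T → ℝ) :
    ∑ v, charge Γ x v = ∑ v, (((Γ.degree v : ℝ) - 1) * x v - Γ.degree v / 2) := by
  have key : ∑ v, (#{w ∈ Γ.neighborFinset v | Γ.degree w = 1} : ℝ) / 2 =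
      ∑ v, if Γ.degree v = 1 then (1 / 2 : ℝ) else 0 := by
    have h : ∀ v, (#{w ∈ Γ.neighborFinset v | Γ.degree w = 1} : ℝ) / 2 =
        ∑ w, if Γ.Adj v w then (if Γ.degree w = 1 then (1 / 2 : ℝ) else 0) else 0 := by
      intro v
      rw [← Finset.sum_filter, ← Finset.sum_filter, Finset.sum_const, neighborFinset_eq_filter,
        nsmul_eq_mul]
      ring
    simp_rw [h]
    rw [Finset.sum_comm]
    refine Finset.sum_congr rfl fun w _ => ?_
    rw [← Finset.sum_filter, Finset.sum_const, nsmul_eq_mul]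
    have : #{v | Γ.Adj v w} = Γ.degree w := by
      rw [← card_neighborFinset_eq_degree, neighborFinset_eq_filter]
      simp_rw [Γ.adj_comm]
    rw [this]
    split_ifs with hw <;> simp [hw]
  simp only [charge, Finset.sum_add_distrib, Finset.sum_sub_distrib, key]
  ring

lemma charge_nonpos {T : Type*} [Fintype T] {Γ : SimpleGraph T} {x : T → ℝ} {v : T}
    (h₀ : 0 ≤ x v) (h₁ : x v ≤ 1) (hv : ¬ 2 < #{w ∈ Γ.neighborFinset v | Γ.degree w ≠ 1}) :
    charge Γ x v ≤ 0 := by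
  have hcard := Finset.card_filter_add_card_filter_not (s := Γ.neighborFinset v)
    (fun w => Γ.degree w = 1)
  rw [card_neighborFinset_eq_degree] at hcard
  have hle : Γ.degree v ≤ #{w ∈ Γ.neighborFinset v | Γ.degree w = 1} + 2 := by
    simp only [ne_eq] at hv
    omega
  have hle' : (Γ.degree v : ℝ) ≤ #{w ∈ Γ.neighborFinset v | Γ.degree w = 1} + 2 := mod_cast hle
  have hl : (0 : ℝ) ≤ #{w ∈ Γ.neighborFinset v | Γ.degree w = 1} := Nat.cast_nonneg _
  unfold charge
  rcases Nat.lt_trichotomy (Γ.degree v) 1 with h | h | h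
  · have : Γ.degree v = 0 := by omega
    simp only [this]
    norm_num
    linarith
  · simp only [h]
    norm_num
    positivity
  · have h2 : (1 : ℝ) < Γ.degree v := mod_cast h
    rw [if_neg h.ne']
    nlinarith

lemma IsDiamond.filter_component_eq {T : Type*} [Fintype T] {Γ : SimpleGraph T} {u a b c : T}
    (h : IsDiamond Γ u a b c) :
    ({v | Γ.connectedComponentMk v = Γ.connectedComponentMk u} : Finset T) = {u, a, b, c} := by
  have hclosed : ∀ v w, Γ.Reachable v w → (v = u ∨ v = a ∨ v = b ∨ v = c) →
      w = u ∨ w = a ∨ w = b ∨ w = c := by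
    rintro v w ⟨p⟩
    induction p with
    | nil => exact id
    | cons hvw _ ih => exact fun hv => ih (h.closed _ _ hv hvw)
  ext v
  simp only [Finset.mem_filter, Finset.mem_univ, true_and, ConnectedComponent.eq,
    Finset.mem_insert, Finset.mem_singleton]
  constructor
  · exact fun hv => hclosed u v hv.symm (.inl rfl)
  · rintro (rfl | rfl | rfl | rfl)
    · exact .refl _
    · exact h.ua.symm.reachable
    · exact h.ub.symm.reachable
    · exact h.uc.symm.reachable

lemma IsDiamond.sum_eq {T : Type*} [DecidableEq T] {Γ : SimpleGraph T} {u a b c : T}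
    (h : IsDiamond Γ u a b c) (f : T → ℝ) :
    ∑ v ∈ ({u, a, b, c} : Finset T), f v = f u + f a + f b + f c := by
  rw [Finset.sum_insert, Finset.sum_insert, Finset.sum_insert, Finset.sum_singleton]
  · ring
  · simpa using h.bc.ne
  · simpa using ⟨h.ba.ne', h.ne⟩
  · simpa using ⟨h.ua.ne, h.ub.ne, h.uc.ne⟩

lemma IsDiamond.sum_charge {T : Type*} [Fintype T] {Γ : SimpleGraph T} {u a b c : T}
    (h : IsDiamond Γ u a b c) (x : T → ℝ) :
    ∑ v ∈ ({u, a, b, c} : Finset T), charge Γ x v =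
      if Γ.Adj a c then 2 * (x u + x a + x b + x c) - 6
      else 2 * (x u + x b) + (x a + x c) - 5 := by
  have key : ∀ v (s : Finset T), Γ.neighborFinset v = s → 2 ≤ #s →
      (∀ w ∈ s, ¬ Γ.degree w = 1) → charge Γ x v = ((#s : ℝ) - 1) * x v - #s / 2 := by
    rintro v s rfl h₂ hs
    rw [charge, Finset.filter_false_of_mem hs, if_neg, card_neighborFinset_eq_degree]
    · simp
    · rw [← card_neighborFinset_eq_degree]
      omega
  have ua := h.ua
  have ub := h.ub
  have uc := h.uc
  have ba := h.ba
  have bc := h.bc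
  have hac := h.ne
  have nu : Γ.neighborFinset u = {a, b, c} := by
    ext w
    have := h.closed u w
    simp only [mem_neighborFinset, Finset.mem_insert, Finset.mem_singleton]
    grind [SimpleGraph.irrefl, SimpleGraph.adj_comm]
  have nb : Γ.neighborFinset b = {u, a, c} := by
    ext w
    have := h.closed b w
    simp only [mem_neighborFinset, Finset.mem_insert, Finset.mem_singleton]
    grind [SimpleGraph.irrefl, SimpleGraph.adj_comm]
  have na : Γ.neighborFinset a = if Γ.Adj a c then {u, b, c} else {u, b} := by
    ext w
    have := h.closed a w
    simp only [mem_neighborFinset]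
    split_ifs <;> simp only [Finset.mem_insert, Finset.mem_singleton] <;>
    grind [SimpleGraph.irrefl, SimpleGraph.adj_comm]
  have nc : Γ.neighborFinset c = if Γ.Adj a c then {u, b, a} else {u, b} := by
    ext w
    have := h.closed c w
    simp only [mem_neighborFinset]
    split_ifs <;> simp only [Finset.mem_insert, Finset.mem_singleton] <;>
    grind [SimpleGraph.irrefl, SimpleGraph.adj_comm]
  have cu : #({a, b, c} : Finset T) = 3 := Finset.card_eq_three.2
    ⟨a, b, c, ba.ne', hac, bc.ne, rfl⟩
  have cb : #({u, a, c} : Finset T) = 3 := Finset.card_eq_three.2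
    ⟨u, a, c, ua.ne, uc.ne, hac, rfl⟩
  have ca : #({u, b, c} : Finset T) = 3 := Finset.card_eq_three.2
    ⟨u, b, c, ub.ne, uc.ne, bc.ne, rfl⟩
  have cc : #({u, b, a} : Finset T) = 3 := Finset.card_eq_three.2
    ⟨u, b, a, ub.ne, ua.ne, ba.ne, rfl⟩
  have c2 : #({u, b} : Finset T) = 2 := Finset.card_pair ub.ne
  have du : ¬ Γ.degree u = 1 := by rw [← card_neighborFinset_eq_degree, nu, cu]; simp
  have db : ¬ Γ.degree b = 1 := by rw [← card_neighborFinset_eq_degree, nb, cb]; simp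
  have da : ¬ Γ.degree a = 1 := by
    rw [← card_neighborFinset_eq_degree, na]
    split_ifs <;> simp [ca, c2]
  have dc : ¬ Γ.degree c = 1 := by
    rw [← card_neighborFinset_eq_degree, nc]
    split_ifs <;> simp [cc, c2]
  rw [h.sum_eq, key u _ nu (by omega) (by simp [da, db, dc]),
    key b _ nb (by omega) (by simp [du, da, dc])]
  split_ifs with hadj
  · rw [if_pos hadj] at na nc
    rw [key a _ na (by omega) (by simp [du, db, dc]), key c _ nc (by omega) (by simp [du, da, db]),
      cu, cb, ca, cc]
    push_cast
    ring
  · rw [if_neg hadj] at na nc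
    rw [key a _ na (by omega) (by simp [du, db]), key c _ nc (by omega) (by simp [du, db]),
      cu, cb, c2]
    push_cast
    ring

/-- In a graph without five-vertex paths the total charge is at most that of the component of a
given `K₄`, provided that no diamond has weight more than `3`. -/
lemma NoP5.sum_charge_le {T : Type*} [Fintype T] {Γ : SimpleGraph T} (hP : NoP5 Γ) {x : T → ℝ}
    (h₀ : ∀ v, 0 ≤ x v) (h₁ : ∀ v, x v ≤ 1)
    (hS : ∀ u a b c, IsDiamond Γ u a b c → x u + x a + x b + x c ≤ 3) {u a b c : T}
    (h : IsDiamond Γ u a b c) (hac : Γ.Adj a c) :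
    ∑ v, charge Γ x v ≤ 2 * (x u + x a + x b + x c) - 6 := by
  have hcomp : ∀ C : Γ.ConnectedComponent,
      ∑ v with Γ.connectedComponentMk v = C, charge Γ x v ≤ 0 := by
    intro C
    by_cases hC : ∃ v, Γ.connectedComponentMk v = C ∧
        2 < #{w ∈ Γ.neighborFinset v | Γ.degree w ≠ 1}
    · obtain ⟨v, rfl, hv⟩ := hC
      obtain ⟨p, q, r, hd⟩ := hP.exists_isDiamond hv
      rw [hd.filter_component_eq, hd.sum_charge]
      have := hS _ _ _ _ hd
      split_ifs <;> linarith [h₁ v, h₁ q]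
    · push Not at hC
      refine Finset.sum_nonpos fun v hv => charge_nonpos (h₀ v) (h₁ v) ?_
      exact (hC v (Finset.mem_filter.1 hv).2).not_gt
  rw [← Finset.sum_fiberwise _ Γ.connectedComponentMk,
    ← Finset.add_sum_erase _ _ (Finset.mem_univ (Γ.connectedComponentMk u)),
    h.filter_component_eq, h.sum_charge, if_pos hac]
  linarith [Finset.sum_nonpos (s := Finset.univ.erase (Γ.connectedComponentMk u))
    fun C _ => hcomp C]

/-- The two basic consequences of `lam ^ 2 - lam ≥ m - 1` for an eigenvector `y` with maximum
`y s = 1` of the adjacency matrix `A` of a graph with `m` edges, where `U` is the set of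
neighbours of `s` and `W` the set of remaining vertices. -/
lemma neg_one_le_and_mul_sum_le {V : Type*} [Fintype V] {A : V → V → ℝ} {s : V} {U W : Finset V}
    {y : V → ℝ} {lam m : ℝ} (hsplit : ∀ f : V → ℝ, ∑ v, f v = f s + ∑ v ∈ U, f v + ∑ v ∈ W, f v)
    (hsymm : ∀ u v, A u v = A v u) (hA : ∀ u v, 0 ≤ A u v) (hss : A s s = 0)
    (hsU : ∀ u ∈ U, A s u = 1) (hsW : ∀ w ∈ W, A s w = 0) (hm : ∑ u, ∑ v, A u v = 2 * m)
    (hys : y s = 1) (hy₁ : ∀ v, y v ≤ 1)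
    (heig : ∀ u, ∑ v, A u v * y v = lam * y u) (hlam : m - 1 ≤ lam ^ 2 - lam) :
    -1 ≤ ∑ u ∈ U, ((∑ v ∈ U, A u v - 1) * y u - (∑ v ∈ U, A u v) / 2) ∧
      lam * ∑ w ∈ W, y w ≤ lam ^ 2 - 3 * lam + 2 := by
  have hUs : ∀ u ∈ U, A u s = 1 := fun u hu => (hsymm u s).trans (hsU u hu)
  have hWs : ∀ w ∈ W, A w s = 0 := fun w hw => (hsymm w s).trans (hsW w hw)
  have hsum : ∑ u ∈ U, y u = lam := by
    have := heig s
    rw [hsplit, hss, hys, Finset.sum_congr rfl fun u hu => by rw [hsU u hu, one_mul],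
      Finset.sum_eq_zero (s := W) fun w hw => by rw [hsW w hw, zero_mul]] at this
    linarith
  have hsq : lam ^ 2 = #U + ∑ u ∈ U, (∑ v ∈ U, A u v) * y u
      + ∑ w ∈ W, (∑ v ∈ U, A w v) * y w := by
    have h : ∀ u ∈ U, lam * y u = 1 + ∑ v ∈ U, A u v * y v + ∑ w ∈ W, A u w * y w := by
      intro u hu
      rw [← heig u, hsplit, hUs u hu, hys, one_mul]
    calc lam ^ 2 = ∑ u ∈ U, lam * y u := by rw [← Finset.mul_sum, hsum, sq]
      _ = _ := by
        rw [Finset.sum_congr rfl h, Finset.sum_add_distrib, Finset.sum_add_distrib,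
          Finset.sum_const, nsmul_one, Finset.sum_comm (s := U) (t := U),
          Finset.sum_comm (s := U) (t := W)]
        simp_rw [Finset.sum_mul, hsymm]
  have hσ : ∑ u ∈ U, ∑ w ∈ W, A u w = ∑ w ∈ W, ∑ u ∈ U, A w u := by
    rw [Finset.sum_comm]
    simp_rw [hsymm]
  have hcount : 2 * m = 2 * #U + ∑ u ∈ U, ∑ v ∈ U, A u v + 2 * ∑ w ∈ W, ∑ u ∈ U, A w u
      + ∑ w ∈ W, ∑ v ∈ W, A w v := by
    rw [← hm, hsplit]
    simp_rw [hsplit (A _)]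
    rw [hss, Finset.sum_congr rfl hsU, Finset.sum_eq_zero hsW, Finset.sum_add_distrib,
      Finset.sum_add_distrib, Finset.sum_add_distrib, Finset.sum_add_distrib,
      Finset.sum_congr rfl hUs, Finset.sum_eq_zero hWs, hσ]
    simp only [Finset.sum_const, nsmul_one]
    ring
  have hcard : lam ≤ #U := by
    rw [← hsum, Finset.cast_card]
    exact Finset.sum_le_sum fun u _ => hy₁ u
  have hγ : ∑ u ∈ U, ((∑ v ∈ U, A u v - 1) * y u - (∑ v ∈ U, A u v) / 2) =
      ∑ u ∈ U, (∑ v ∈ U, A u v) * y u - lam - (∑ u ∈ U, ∑ v ∈ U, A u v) / 2 := by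
    rw [Finset.sum_sub_distrib, ← Finset.sum_div, ← hsum, ← Finset.sum_sub_distrib]
    simp_rw [sub_mul, one_mul]
  have hWU : ∑ w ∈ W, (∑ v ∈ U, A w v) * y w ≤ ∑ w ∈ W, ∑ v ∈ U, A w v :=
    Finset.sum_le_sum fun w _ =>
      mul_le_of_le_one_right (Finset.sum_nonneg fun v _ => hA w v) (hy₁ w)
  have hUU : ∑ u ∈ U, (∑ v ∈ U, A u v) * y u ≤ ∑ u ∈ U, ∑ v ∈ U, A u v :=
    Finset.sum_le_sum fun u _ =>
      mul_le_of_le_one_right (Finset.sum_nonneg fun v _ => hA u v) (hy₁ u)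
  have hWW : 0 ≤ ∑ w ∈ W, ∑ v ∈ W, A w v :=
    Finset.sum_nonneg fun w _ => Finset.sum_nonneg fun v _ => hA w v
  have hT : lam * ∑ w ∈ W, y w ≤ ∑ w ∈ W, ∑ v ∈ U, A w v + ∑ w ∈ W, ∑ v ∈ W, A w v := by
    rw [Finset.mul_sum, ← Finset.sum_add_distrib]
    refine Finset.sum_le_sum fun w hw => ?_
    rw [← heig w, hsplit, hWs w hw, zero_mul, zero_add]
    exact add_le_add (Finset.sum_le_sum fun v _ => mul_le_of_le_one_right (hA w v) (hy₁ v))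
      (Finset.sum_le_sum fun v _ => mul_le_of_le_one_right (hA w v) (hy₁ v))
  constructor <;> linarith

/-- A set `H` of neighbours of `s` without further neighbours in `U`, and with at most `k`
neighbours in `H` for each vertex of `W`, has bounded weight. -/
lemma mul_sum_le_of_closed {V : Type*} [Fintype V] {A : V → V → ℝ} {s : V} {U W H : Finset V}
    {y : V → ℝ} {lam k : ℝ} (hsplit : ∀ f : V → ℝ, ∑ v, f v = f s + ∑ v ∈ U, f v + ∑ v ∈ W, f v)
    (hA₁ : ∀ u v, A u v ≤ 1) (hys : y s = 1)
    (hy₀ : ∀ v, 0 ≤ y v) (heig : ∀ u, ∑ v, A u v * y v = lam * y u) (hHU : H ⊆ U)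
    (hUs : ∀ u ∈ U, A u s = 1) (hclosed : ∀ v ∈ H, ∀ w ∈ U, w ∉ H.erase v → A v w = 0)
    (hk : ∀ w ∈ W, ∑ v ∈ H, A v w ≤ k) :
    lam * ∑ v ∈ H, y v ≤ #H + (#H - 1) * ∑ v ∈ H, y v + k * ∑ w ∈ W, y w := by
  have h : ∀ v ∈ H, lam * y v ≤ 1 + (∑ w ∈ H, y w - y v) + ∑ w ∈ W, A v w * y w := by
    intro v hv
    rw [← heig v, hsplit, hUs v (hHU hv), hys, one_mul]
    gcongr
    rw [← Finset.sum_erase_eq_sub hv, ← Finset.sum_subset ((Finset.erase_subset v H).trans hHU)]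
    · exact Finset.sum_le_sum fun w _ => mul_le_of_le_one_left (hy₀ w) (hA₁ v w)
    · intro w hw hw'
      rw [hclosed v hv w hw hw', zero_mul]
  have hW : ∑ v ∈ H, ∑ w ∈ W, A v w * y w ≤ k * ∑ w ∈ W, y w := by
    rw [Finset.sum_comm, Finset.mul_sum]
    refine Finset.sum_le_sum fun w hw => ?_
    rw [← Finset.sum_mul]
    exact mul_le_mul_of_nonneg_right (hk w hw) (hy₀ w)
  rw [Finset.mul_sum]
  refine (Finset.sum_le_sum h).trans ?_
  rw [Finset.sum_add_distrib, Finset.sum_add_distrib, Finset.sum_sub_distrib]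
  simp only [Finset.sum_const, nsmul_eq_mul, mul_one]
  linarith

/-- Outside the closed neighbourhood of `s`, a vertex has at most one neighbour in a `K₄`, and at
most two in a `K₄` minus an edge, that forms a component of the neighbourhood of `s`. -/
lemma F6Free.sum_adj_diamond_le {V : Type*} {G : SimpleGraph V} (hG : F6Free G) {s w : V}
    (hw : ¬ G.Adj s w) (hws : w ≠ s) {u a b c : G.neighborSet s}
    (h : IsDiamond (G.induce (G.neighborSet s)) u a b c) :
    (if G.Adj u w then (1 : ℝ) else 0) + (if G.Adj a w then 1 else 0)
      + (if G.Adj b w then 1 else 0) + (if G.Adj c w then 1 else 0)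
      ≤ if G.Adj a c then 1 else 2 := by
  have ua : G.Adj u a := h.ua
  have ub : G.Adj u b := h.ub
  have uc : G.Adj u c := h.uc
  have ba : G.Adj b a := h.ba
  have bc : G.Adj b c := h.bc
  have hac : (a : V) ≠ c := fun e => h.ne (Subtype.ext e)
  have su : G.Adj s u := u.2
  have sa : G.Adj s a := a.2
  have sb : G.Adj s b := b.2
  have sc : G.Adj s c := c.2
  have wua : G.Adj w u → ¬ G.Adj w a :=
    hG.not_adj_of_adj hw su sa sc sb ua uc ub ba.symm hac bc.ne hws
  have wuc : G.Adj w u → ¬ G.Adj w c :=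
    hG.not_adj_of_adj hw su sc sa sb uc ua ub bc.symm hac.symm ba.ne hws
  have wub : G.Adj w u → ¬ G.Adj w b :=
    hG.not_adj_of_adj hw su sb sc sa ub uc ua ba bc.ne hac hws
  have wba : G.Adj w b → ¬ G.Adj w a :=
    hG.not_adj_of_adj hw sb sa sc su ba bc ub.symm ua.symm hac uc.ne hws
  have wbc : G.Adj w b → ¬ G.Adj w c :=
    hG.not_adj_of_adj hw sb sc sa su bc ba ub.symm uc.symm hac.symm ua.ne hws
  have wac : G.Adj a c → G.Adj w a → ¬ G.Adj w c := fun ac =>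
    hG.not_adj_of_adj hw sa sc sb su ac ba.symm ua.symm uc.symm bc.ne' ub.ne hws
  simp only [G.adj_comm _ w]
  by_cases h₁ : G.Adj w u <;> by_cases h₂ : G.Adj w a <;> by_cases h₃ : G.Adj w b <;>
    by_cases h₄ : G.Adj w c <;> by_cases h₅ : G.Adj a c <;> (simp_all; try norm_num)

lemma exists_isDiamond_of_iso {V : Type*} {G : SimpleGraph V} {U : Set V}
    {C : (G.induce U).ConnectedComponent}
    (e : G.induce (Subtype.val '' C.supp) ≃g completeGraph (Fin 4)) :
    ∃ u a b c, IsDiamond (G.induce U) u a b c ∧ (G.induce U).Adj a c := by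
  choose t htC ht using fun i => (e.symm i).2
  have hadj : ∀ i j, i ≠ j → (G.induce U).Adj (t i) (t j) := by
    intro i j hij
    have : (G.induce (Subtype.val '' C.supp)).Adj (e.symm i) (e.symm j) :=
      e.symm.map_adj_iff.2 hij
    simpa [ht] using this
  refine ⟨t 0, t 1, t 2, t 3, ⟨hadj _ _ (by decide), hadj _ _ (by decide), hadj _ _ (by decide),
    hadj _ _ (by decide), hadj _ _ (by decide), (hadj 1 3 (by decide)).ne, ?_⟩,
    hadj _ _ (by decide)⟩
  intro v w hv hvw
  have hvC : v ∈ C.supp := by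
    rcases hv with rfl | rfl | rfl | rfl <;> exact htC _
  have hwC : w ∈ C.supp := C.mem_supp_of_adj_mem_supp hvC hvw
  obtain ⟨i, hi⟩ : ∃ i, w = t i :=
    ⟨e ⟨w, w, hwC, rfl⟩, Subtype.ext (by rw [ht, e.symm_apply_apply])⟩
  subst hi
  fin_cases i <;> simp

/-- The adjacency-sum form of the main result: for a normalised eigenvector whose eigenvalue
satisfies `lam ^ 2 - lam ≥ m - 1`, no component of the neighbourhood of `s` is a `K₄`. -/
lemma F6Free.not_adj_of_isDiamond {V : Type*} [Fintype V] {G : SimpleGraph V} (hG : F6Free G)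
    {s : V} {y : V → ℝ} {lam : ℝ} (hlam : (#G.edgeFinset : ℝ) - 1 ≤ lam ^ 2 - lam)
    (hlam' : 9 ≤ lam) (hys : y s = 1) (hy₀ : ∀ v, 0 ≤ y v) (hy₁ : ∀ v, y v ≤ 1)
    (heig : ∀ u, ∑ v, (if G.Adj u v then (1 : ℝ) else 0) * y v = lam * y u)
    {u a b c : G.neighborSet s} (h : IsDiamond (G.induce (G.neighborSet s)) u a b c) :
    ¬ G.Adj a c := by
  intro hac
  set A : V → V → ℝ := fun u v => if G.Adj u v then 1 else 0 with hA
  set U : Finset V := G.neighborFinset s with hU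
  set W : Finset V := {w | w ≠ s ∧ ¬ G.Adj s w} with hW
  set Γ := G.induce (G.neighborSet s) with hΓ
  have hsplit : ∀ f : V → ℝ, ∑ v, f v = f s + ∑ v ∈ U, f v + ∑ v ∈ W, f v := by
    intro f
    have hWeq : W = {w ∈ Finset.univ.erase s | ¬ G.Adj s w} := by
      ext w
      simp [hW]
    have hUeq : U = {w ∈ Finset.univ.erase s | G.Adj s w} := by
      ext w
      simpa [hU] using fun e : G.Adj s w => e.ne'
    rw [hWeq, hUeq, add_assoc, Finset.sum_filter_add_sum_filter_not,
      Finset.add_sum_erase _ _ (Finset.mem_univ s)]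
  have hUsum : ∀ f : V → ℝ, ∑ v ∈ U, f v = ∑ v : G.neighborSet s, f v := fun f =>
    Finset.sum_subtype U (fun v => by simp [hU]) f
  have hm : ∑ u, ∑ v, A u v = 2 * (#G.edgeFinset : ℝ) := by
    have := G.sum_degrees_eq_twice_card_edges
    rw [← Nat.cast_inj (R := ℝ)] at this
    push_cast at this
    rw [← this]
    refine Finset.sum_congr rfl fun v _ => ?_
    rw [← card_neighborFinset_eq_degree, neighborFinset_eq_filter]
    simp [hA]
  obtain ⟨hγ, hT⟩ := neg_one_le_and_mul_sum_le (A := A) (s := s) (U := U) (W := W) hsplit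
    (fun u v => by simp only [hA, G.adj_comm]) (fun u v => by simp only [hA]; positivity)
    (by simp [hA]) (by simp +contextual [hA, hU]) (by simp +contextual [hA, hW]) hm hys hy₁ heig
    hlam
  have hdiamond : ∀ u a b c, IsDiamond Γ u a b c →
      lam * (y u + y a + y b + y c) ≤ 4 + 3 * (y u + y a + y b + y c)
        + (if G.Adj a c then 1 else 2) * ∑ w ∈ W, y w := by
    intro u a b c hd
    have hmap : ∀ f : V → ℝ,
        ∑ v ∈ ({u, a, b, c} : Finset (G.neighborSet s)).map (.subtype _), f v =
          f u + f a + f b + f c := by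
      intro f
      rw [Finset.sum_map]
      exact hd.sum_eq (fun v => f v)
    have hcard : #(({u, a, b, c} : Finset (G.neighborSet s)).map (.subtype _)) = 4 := by
      have := hmap fun _ => 1
      rw [Finset.sum_const, nsmul_one] at this
      exact_mod_cast this.trans (by norm_num : (1 + 1 + 1 + 1 : ℝ) = 4)
    have := mul_sum_le_of_closed (A := A) (s := s) (U := U) (W := W)
      (H := ({u, a, b, c} : Finset (G.neighborSet s)).map (.subtype _))
      (k := if G.Adj a c then 1 else 2) hsplit (fun u v => by simp only [hA]; split_ifs <;> norm_num)
      hys hy₀ heig ?_ (by simp +contextual [hA, hU, G.adj_comm]) ?_ ?_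
    · rw [hmap, hcard] at this
      norm_num at this ⊢
      exact this
    · intro v hv
      obtain ⟨v, -, rfl⟩ := Finset.mem_map.1 hv
      exact (G.mem_neighborFinset _ _).2 v.2
    · intro v hv w hw hvw
      obtain ⟨v, hv', rfl⟩ := Finset.mem_map.1 hv
      refine if_neg fun e => hvw (Finset.mem_erase.2 ⟨e.ne', Finset.mem_map.2
        ⟨⟨w, (G.mem_neighborFinset _ _).1 hw⟩, ?_, rfl⟩⟩)
      have := hd.closed v ⟨w, (G.mem_neighborFinset _ _).1 hw⟩ (by simpa using hv') e
      simpa using this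
    · intro w hw
      rw [hmap]
      obtain ⟨-, hws, hw⟩ := Finset.mem_filter.1 hw
      exact hG.sum_adj_diamond_le hw hws hd
  have hS : ∀ u a b c, IsDiamond Γ u a b c → y u + y a + y b + y c ≤ 3 := by
    intro u a b c hd
    have h₁ := hdiamond u a b c hd
    have hW₀ : 0 ≤ ∑ w ∈ W, y w := Finset.sum_nonneg fun w _ => hy₀ w
    have h₂ : lam * (y u + y a + y b + y c) ≤ 4 + 3 * (y u + y a + y b + y c)
        + 2 * ∑ w ∈ W, y w := by
      split_ifs at h₁ <;> linarith
    by_contra! hlt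
    nlinarith [mul_pos (mul_pos (by linarith : 0 < lam) (by linarith : 0 < lam - 3))
      (sub_pos.2 hlt)]
  have hle := NoP5.sum_charge_le (Γ := Γ) (hG.noP5_induce s) (x := fun v => y v) (fun v => hy₀ v)
    (fun v => hy₁ v) hS h hac
  have hdeg : ∀ (v : G.neighborSet s) [Fintype (Γ.neighborSet v)],
      (Γ.degree v : ℝ) = ∑ w ∈ U, A v w := by
    intro v _
    have hcard : Γ.degree v = #{w | Γ.Adj v w} := by
      rw [← card_neighborFinset_eq_degree]
      congr 1
      ext w
      simp
    rw [hUsum, hcard]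
    simp [hA, hΓ]
  rw [sum_charge] at hle
  simp only [hdeg] at hle
  rw [hUsum] at hγ
  have h₁ := hdiamond u a b c h
  rw [if_pos hac, one_mul] at h₁
  have hlt : 5 / 2 ≤ y u + y a + y b + y c := by linarith
  nlinarith [mul_nonneg (mul_nonneg (by linarith : 0 ≤ lam) (by linarith : 0 ≤ lam - 3))
    (sub_nonneg.2 hlt)]

theorem stmt_13 
    {V : Type} [Fintype V] [DecidableEq V] (G : SimpleGraph V) [DecidableRel G.Adj]
    (m : ℕ) (hm : 88 ≤ m)
    (hfree : F6Free G)
    (hcard : G.edgeSet.ncard = m)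
    (hnoiso : ∀ v : V, ∃ w, G.Adj v w)
    (hmax : ∀ (n : ℕ) (G' : SimpleGraph (Fin n)), F6Free G' → G'.edgeSet.ncard = m →
      (∀ v, ∃ w, G'.Adj v w) → specRad G' ≤ specRad G)
    (lam : ℝ) (hlam : lam = specRad G)
    (hconn : G.Connected)
    (hlow : (1 + Real.sqrt (4 * (m : ℝ) - 3)) / 2 ≤ lam)
    (x : V → ℝ) (hxpos : ∀ v, 0 < x v)
    (heig : (G.adjMatrix ℝ).mulVec x = lam • x)
    (ustar : V) (hustar : ∀ v, x v ≤ x ustar)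
    :
    ∀ C : (G.induce (G.neighborSet ustar)).ConnectedComponent,
      ¬ Nonempty ((G.induce (Subtype.val '' C.supp)) ≃g completeGraph (Fin 4)) := by
  rintro C ⟨e⟩
  obtain ⟨u, a, b, c, hd, hac⟩ := exists_isDiamond_of_iso e
  have hedges : (m : ℝ) = #G.edgeFinset := by
    rw [← hcard, ← coe_edgeFinset, Set.ncard_coe_finset]
  have hm' : (88 : ℝ) ≤ m := mod_cast hm
  have hsqrt := Real.sq_sqrt (by linarith : (0 : ℝ) ≤ 4 * m - 3)
  have hsqrt' : (17 : ℝ) ≤ Real.sqrt (4 * m - 3) := Real.le_sqrt_of_sq_le (by linarith)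
  have hs := hxpos ustar
  have hadj : ∀ v, ∑ w, (if G.Adj v w then (1 : ℝ) else 0) * x w = lam * x v := by
    intro v
    have := congrFun heig v
    simp only [Matrix.mulVec, dotProduct, adjMatrix_apply, Pi.smul_apply, smul_eq_mul] at this
    rw [← this]
  refine hfree.not_adj_of_isDiamond (y := fun v => x v / x ustar) (lam := lam) ?_ (by linarith)
    (div_self hs.ne') (fun v => (div_pos (hxpos v) hs).le) (fun v => (div_le_one hs).2 (hustar v))
    (fun v => ?_) hd hac
  · convert (by nlinarith : (m : ℝ) - 1 ≤ lam ^ 2 - lam)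
    rw [← Nat.cast_inj (R := ℝ), hedges]
    congr!
  · simp only [← mul_div_assoc]
    rw [← Finset.sum_div, ← hadj v]
    congr!
end
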